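/- Let α ∈ (0,1) and δ ∈ (0,1) be constants. Then there exist a constant c > 0 and N such that for all n ≥ N with αn an integer, every switching network of depth d on [n] that (starting from 1^{αn} 0^{n−αn}) generates a distribution X with Δ(X, U_{αn}^n) ≤ 1 − δ satisfies d ≥ c·log log n. -/

import Mathlib

open Finset

/-- Hamming weight of a bit string. -/
def wt {n : ℕ} (x : Fin n → Bool) : ℕ := (Finset.univ.filter fun i => x i = true).card

/-- Binary decision trees querying input bits. -/
inductive DTree (m : ℕ) : Type
  | leaf : Bool → DTree m
  | node : Fin m → DTree m → DTree m → DTree m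

def DTree.eval {m : ℕ} : DTree m → (Fin m → Bool) → Bool
  | .leaf b, _ => b
  | .node i t0 t1, y => if y i then t1.eval y else t0.eval y

def DTree.depth {m : ℕ} : DTree m → ℕ
  | .leaf _ => 0
  | .node _ t0 t1 => max t0.depth t1.depth + 1

/-- `f` has decision depth `d`: every output bit is computed by a depth-`≤ d` decision tree. -/
def hasDecisionDepth {m n : ℕ} (f : (Fin m → Bool) → (Fin n → Bool)) (d : ℕ) : Prop :=
  ∀ j : Fin n, ∃ t : DTree m, t.depth ≤ d ∧ ∀ y, f y j = t.eval y

/-- The mass function of the distribution `f(Y)` for `Y` uniform on `{0,1}^m`. -/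
noncomputable def srcDist {m n : ℕ} (f : (Fin m → Bool) → (Fin n → Bool)) :
    (Fin n → Bool) → ℝ :=
  fun x => ((Finset.univ.filter fun y => f y = x).card : ℝ) / 2 ^ m

/-- The mass function of the uniform distribution on Hamming-weight-`k` strings. -/
noncomputable def uniformSlice (n k : ℕ) : (Fin n → Bool) → ℝ :=
  fun x => if wt x = k then 1 / (n.choose k : ℝ) else 0

/-- Statistical distance between two mass functions: `max_A |P(A) - Q(A)|`. -/
noncomputable def SD {α : Type*} [Fintype α] (P Q : α → ℝ) : ℝ :=
  ⨆ A : Finset α, |∑ x ∈ A, P x - ∑ x ∈ A, Q x|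

/-- A partial matching on `[n]`: a set of pairs with all endpoints distinct. -/
def IsMatching {n : ℕ} (M : Finset (Fin n × Fin n)) : Prop :=
  (∀ p ∈ M, p.1 ≠ p.2) ∧
  ∀ p ∈ M, ∀ q ∈ M, p ≠ q → p.1 ≠ q.1 ∧ p.1 ≠ q.2 ∧ p.2 ≠ q.1 ∧ p.2 ≠ q.2

/-- Apply one layer of a switching network: for each pair `p` of the matching `M` whose
coin `b p` came up heads, swap the two corresponding coordinates of the string. -/
noncomputable def applyLayer {n : ℕ} (M : Finset (Fin n × Fin n)) (b : Fin n × Fin n → Bool)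
    (x : Fin n → Bool) : Fin n → Bool :=
  M.toList.foldl (fun y p => if b p then fun a => y (Equiv.swap p.1 p.2 a) else y) x

/-- The output of a depth-`d` switching network `M` on initial string `x₀`, given the coin
tosses `b` (one fair coin per pair per layer). -/
noncomputable def networkOutput {n d : ℕ} (M : Fin d → Finset (Fin n × Fin n))
    (b : Fin d → Fin n × Fin n → Bool) (x₀ : Fin n → Bool) : Fin n → Bool :=
  (List.finRange d).foldl (fun x i => applyLayer (M i) (b i) x) x₀

/-- The mass function of the distribution generated by the switching network `M` started
from `x₀`, over independent fair coins. -/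
noncomputable def networkDist {n d : ℕ} (M : Fin d → Finset (Fin n × Fin n))
    (x₀ : Fin n → Bool) : (Fin n → Bool) → ℝ :=
  fun x => ((Finset.univ.filter fun b : Fin d → Fin n × Fin n → Bool =>
      networkOutput M b x₀ = x).card : ℝ) /
    ((Finset.univ : Finset (Fin d → Fin n × Fin n → Bool)).card : ℝ)

/-- The initial string `1^ℓ 0^{n-ℓ}`. -/
def initString (n ℓ : ℕ) : Fin n → Bool := fun a => decide ((a : ℕ) < ℓ)

/-- `0/1` indicator of a bit. -/
noncomputable def chi {n : ℕ} (x : Fin n → Bool) (a : Fin n) : ℝ := if x a = true then 1 else 0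

/-- Expectation with respect to a mass function. -/
noncomputable def EE {Ω : Type*} [Fintype Ω] (P : Ω → ℝ) (f : Ω → ℝ) : ℝ := ∑ x, P x * f x

/-- Closed neighbourhood of a position in a matching. -/
noncomputable def nbr {n : ℕ} (M : Finset (Fin n × Fin n)) (a : Fin n) : Finset (Fin n) :=
  univ.filter fun a' => a' = a ∨ (a, a') ∈ M ∨ (a', a) ∈ M

lemma nbr_self {n : ℕ} (M : Finset (Fin n × Fin n)) (a : Fin n) : a ∈ nbr M a := by
  simp [nbr]

lemma nbr_symm {n : ℕ} (M : Finset (Fin n × Fin n)) {a b : Fin n} (h : a ∈ nbr M b) :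
    b ∈ nbr M a := by
  simp only [nbr, mem_filter, mem_univ, true_and] at h ⊢
  tauto

lemma nbr_card {n : ℕ} (M : Finset (Fin n × Fin n)) (hM : IsMatching M) (a : Fin n) :
    (nbr M a).card ≤ 2 := by
  by_cases h : ∃ p ∈ M, p.1 = a ∨ p.2 = a
  · obtain ⟨p, hp, hpa⟩ := h
    have : nbr M a ⊆ {p.1, p.2} := by
      intro c hc
      simp only [nbr, mem_filter, mem_univ, true_and] at hc
      simp only [mem_insert, mem_singleton]
      have key : ∀ q ∈ M, (q.1 = a ∨ q.2 = a) → q = p := by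
        intro q hq hqa
        by_contra hne
        have := hM.2 q hq p hp hne
        grind
      rcases hc with h | h | h
      · grind
      · have := key _ h (Or.inl rfl); subst this; simp
      · have := key _ h (Or.inr rfl); subst this; simp
    exact (card_le_card this).trans card_le_two
  · have : nbr M a ⊆ {a} := by
      intro c hc
      simp only [nbr, mem_filter, mem_univ, true_and] at hc
      simp only [mem_singleton]
      rcases hc with h' | h' | h'
      · exact h'
      · exact absurd ⟨_, h', Or.inl rfl⟩ h
      · exact absurd ⟨_, h', Or.inr rfl⟩ h
    exact (card_le_card this).trans (by simp)

lemma layer_local_list {n : ℕ} (L : List (Fin n × Fin n))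
    (hL : L.Pairwise fun p q => p.1 ≠ q.1 ∧ p.1 ≠ q.2 ∧ p.2 ≠ q.1 ∧ p.2 ≠ q.2)
    (b b' : Fin n × Fin n → Bool) (x x' : Fin n → Bool) (a : Fin n)
    (hx : ∀ a', (a' = a ∨ (a, a') ∈ L ∨ (a', a) ∈ L) → x a' = x' a')
    (hb : ∀ p ∈ L, (p.1 = a ∨ p.2 = a) → b p = b' p) :
    L.foldl (fun y p => if b p then fun a => y (Equiv.swap p.1 p.2 a) else y) x a =
    L.foldl (fun y p => if b' p then fun a => y (Equiv.swap p.1 p.2 a) else y) x' a := by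
  induction L generalizing x x' with
  | nil => simpa using hx a (Or.inl rfl)
  | cons p L ih =>
    rw [List.pairwise_cons] at hL
    simp only [List.foldl_cons]
    apply ih hL.2
    · intro a' ha'
      by_cases hpa : p.1 = a ∨ p.2 = a
      · have hbp := hb p (by simp) hpa
        have haa : a' = a := by
          rcases ha' with h | h | h
          · exact h
          · have := hL.1 _ h; grind
          · have := hL.1 _ h; grind
        subst haa
        rw [hbp]
        have h1 : x p.1 = x' p.1 := by
          apply hx
          rcases hpa with h | h
          · exact Or.inl h
          · right; right; rw [← h]; simp
        have h2 : x p.2 = x' p.2 := by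
          apply hx
          rcases hpa with h | h
          · right; left; rw [← h]; simp
          · exact Or.inl h
        split
        · rcases hpa with h | h
          · rw [← h]; simpa using h2
          · rw [← h]; simpa using h1
        · rcases hpa with h | h
          · rw [← h]; simpa using h1
          · rw [← h]; simpa using h2
      · push Not at hpa
        have hne : a' ≠ p.1 ∧ a' ≠ p.2 := by
          rcases ha' with h | h | h
          · subst h; exact ⟨hpa.1.symm, hpa.2.symm⟩
          · have := hL.1 _ h; grind
          · have := hL.1 _ h; grind
        have hxx : x a' = x' a' := by
          apply hx
          rcases ha' with h | h | h
          · exact Or.inl h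
          · exact Or.inr (Or.inl (List.mem_cons_of_mem _ h))
          · exact Or.inr (Or.inr (List.mem_cons_of_mem _ h))
        have hs := Equiv.swap_apply_of_ne_of_ne hne.1 hne.2
        split <;> split <;> simp [hs, hxx]
    · intro q hq h
      exact hb q (List.mem_cons_of_mem _ hq) h

lemma layer_local {n : ℕ} (M : Finset (Fin n × Fin n)) (hM : IsMatching M)
    (b b' : Fin n × Fin n → Bool) (x x' : Fin n → Bool) (a : Fin n)
    (hx : ∀ a' ∈ nbr M a, x a' = x' a')
    (hb : ∀ p ∈ M, (p.1 = a ∨ p.2 = a) → b p = b' p) :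
    applyLayer M b x a = applyLayer M b' x' a := by
  unfold applyLayer
  apply layer_local_list
  · apply List.Nodup.pairwise_of_forall_ne M.nodup_toList
    intro p hp q hq hne
    exact hM.2 p (by simpa using hp) q (by simpa using hq) hne
  · intro a' ha'
    apply hx
    simpa [nbr] using ha'
  · intro p hp h
    exact hb p (by simpa using hp) h

lemma wt_swap {n : ℕ} (x : Fin n → Bool) (σ : Equiv.Perm (Fin n)) :
    wt (fun a => x (σ a)) = wt x := by
  unfold wt
  apply Finset.card_bij (fun a _ => σ a)
  · intro a ha; simpa using ha
  · intro a _ b _ h; exact σ.injective h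
  · intro b hb; exact ⟨σ.symm b, by simpa using hb, by simp⟩

lemma wt_layer {n : ℕ} (M : Finset (Fin n × Fin n))
    (b : Fin n × Fin n → Bool) (x : Fin n → Bool) : wt (applyLayer M b x) = wt x := by
  unfold applyLayer
  generalize M.toList = L
  induction L generalizing x with
  | nil => rfl
  | cons p L ih =>
    rw [List.foldl_cons, ih]
    split
    · exact wt_swap x _
    · rfl

lemma wt_net {n d : ℕ} (M : Fin d → Finset (Fin n × Fin n))
    (b : Fin d → Fin n × Fin n → Bool) (x : Fin n → Bool) :
    wt (networkOutput M b x) = wt x := by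
  unfold networkOutput
  generalize List.finRange d = L
  induction L generalizing x with
  | nil => rfl
  | cons p L ih => rw [List.foldl_cons, ih, wt_layer]

/-- Ancestors of an output position. -/
noncomputable def anc {n d : ℕ} (M : Fin d → Finset (Fin n × Fin n)) :
    List (Fin d) → Fin n → Finset (Fin n)
  | [], j => {j}
  | i :: l, j => (anc M l j).biUnion (nbr (M i))

/-- Coins which an output position may depend on. -/
def coins {n d : ℕ} (M : Fin d → Finset (Fin n × Fin n)) :
    List (Fin d) → Fin n → Set (Fin d × (Fin n × Fin n))
  | [], _ => ∅
  | i :: l, j => {c | c.1 = i ∧ c.2 ∈ M i ∧ (c.2.1 ∈ anc M l j ∨ c.2.2 ∈ anc M l j)} ∪ coins M l j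

lemma net_local {n d : ℕ} (M : Fin d → Finset (Fin n × Fin n)) (hM : ∀ i, IsMatching (M i))
    (l : List (Fin d)) (b b' : Fin d → Fin n × Fin n → Bool) (x x' : Fin n → Bool) (j : Fin n)
    (hx : ∀ a ∈ anc M l j, x a = x' a) (hb : ∀ c ∈ coins M l j, b c.1 c.2 = b' c.1 c.2) :
    l.foldl (fun x i => applyLayer (M i) (b i) x) x j =
    l.foldl (fun x i => applyLayer (M i) (b' i) x) x' j := by
  induction l generalizing x x' with
  | nil => exact hx j (by simp [anc])
  | cons i l ih =>
    simp only [List.foldl_cons]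
    apply ih
    · intro a ha
      apply layer_local (M i) (hM i)
      · intro a' ha'
        apply hx
        simp only [anc, mem_biUnion]
        exact ⟨a, ha, ha'⟩
      · intro p hp hpa
        apply hb (i, p)
        left
        refine ⟨rfl, hp, ?_⟩
        rcases hpa with h | h
        · left; simpa [h] using ha
        · right; simpa [h] using ha
    · intro c hc
      exact hb c (Or.inr hc)

lemma coins_fst {n d : ℕ} (M : Fin d → Finset (Fin n × Fin n)) (l : List (Fin d)) (j : Fin n)
    (c) (hc : c ∈ coins M l j) : c.1 ∈ l := by
  induction l with
  | nil => exact hc.elim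
  | cons i l ih =>
    rcases hc with h | h
    · simp [h.1]
    · exact List.mem_cons_of_mem _ (ih h)

lemma coins_disj {n d : ℕ} (M : Fin d → Finset (Fin n × Fin n)) (l : List (Fin d))
    (hl : l.Nodup) (j j' : Fin n) (c) (hc : c ∈ coins M l j) (hc' : c ∈ coins M l j') :
    ∃ u, u ∈ anc M l j ∧ u ∈ anc M l j' := by
  induction l with
  | nil => exact hc.elim
  | cons i l ih =>
    rw [List.nodup_cons] at hl
    rcases hc with h | h <;> rcases hc' with h' | h'
    · have key : ∀ j, (c.2.1 ∈ anc M l j ∨ c.2.2 ∈ anc M l j) → c.2.1 ∈ anc M (i :: l) j := by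
        intro j hj
        simp only [anc, mem_biUnion]
        rcases hj with hj | hj
        · exact ⟨_, hj, nbr_self _ _⟩
        · refine ⟨_, hj, ?_⟩
          simp only [nbr, mem_filter, mem_univ, true_and]
          exact Or.inr (Or.inr h.2.1)
      exact ⟨c.2.1, key j h.2.2, key j' h'.2.2⟩
    · have := coins_fst M l _ c h'
      rw [h.1] at this; exact absurd this hl.1
    · have := coins_fst M l _ c h
      rw [h'.1] at this; exact absurd this hl.1
    · obtain ⟨u, h1, h2⟩ := ih hl.2 h h'
      refine ⟨u, ?_, ?_⟩
      · simp only [anc, mem_biUnion]; exact ⟨u, h1, nbr_self _ _⟩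
      · simp only [anc, mem_biUnion]; exact ⟨u, h2, nbr_self _ _⟩

lemma anc_card {n d : ℕ} (M : Fin d → Finset (Fin n × Fin n)) (hM : ∀ i, IsMatching (M i))
    (l : List (Fin d)) (j : Fin n) : (anc M l j).card ≤ 2 ^ l.length := by
  induction l with
  | nil => simp [anc]
  | cons i l ih =>
    simp only [anc, List.length_cons, pow_succ]
    refine (Finset.card_biUnion_le_card_mul _ _ 2 fun a _ => nbr_card _ (hM i) a).trans ?_
    exact Nat.mul_le_mul_right _ ih

lemma desc_card {n d : ℕ} (M : Fin d → Finset (Fin n × Fin n)) (hM : ∀ i, IsMatching (M i))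
    (l : List (Fin d)) (u : Fin n) :
    (univ.filter fun j => u ∈ anc M l j).card ≤ 2 ^ l.length := by
  induction l generalizing u with
  | nil =>
    simp only [anc, mem_singleton, List.length_nil, pow_zero]
    simp [Finset.filter_eq]
  | cons i l ih =>
    have hsub : (univ.filter fun j => u ∈ anc M (i :: l) j) ⊆
        (nbr (M i) u).biUnion fun v => univ.filter fun j => v ∈ anc M l j := by
      intro j hj
      simp only [anc, mem_biUnion, mem_filter, mem_univ, true_and] at hj ⊢
      obtain ⟨v, hv, huv⟩ := hj
      exact ⟨v, nbr_symm _ huv, hv⟩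
    refine (card_le_card hsub).trans ?_
    refine (Finset.card_biUnion_le_card_mul _ _ _ fun a _ => ih a).trans ?_
    rw [List.length_cons, pow_succ, mul_comm]
    exact Nat.mul_le_mul_left _ (nbr_card _ (hM i) u)

/-- Dependency relation between output positions. -/
def dep {n d : ℕ} (M : Fin d → Finset (Fin n × Fin n)) (j j' : Fin n) : Prop :=
  ∃ u, u ∈ anc M (List.finRange d) j ∧ u ∈ anc M (List.finRange d) j'

lemma anc_nonempty {n d : ℕ} (M : Fin d → Finset (Fin n × Fin n)) (l : List (Fin d))
    (j : Fin n) : j ∈ anc M l j := by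
  induction l with
  | nil => simp [anc]
  | cons i l ih => simp only [anc, mem_biUnion]; exact ⟨j, ih, nbr_self _ _⟩

lemma dep_refl {n d : ℕ} (M : Fin d → Finset (Fin n × Fin n)) (j : Fin n) : dep M j j :=
  ⟨j, anc_nonempty _ _ _, anc_nonempty _ _ _⟩

lemma dep_symm {n d : ℕ} (M : Fin d → Finset (Fin n × Fin n)) (j j' : Fin n)
    (h : dep M j j') : dep M j' j := by
  obtain ⟨u, h1, h2⟩ := h
  exact ⟨u, h2, h1⟩

open Classical in
lemma dep_card {n d : ℕ} (M : Fin d → Finset (Fin n × Fin n)) (hM : ∀ i, IsMatching (M i))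
    (j : Fin n) : (univ.filter fun j' => dep M j j').card ≤ 4 ^ d := by
  have hsub : (univ.filter fun j' => dep M j j') ⊆
      (anc M (List.finRange d) j).biUnion
        fun v => univ.filter fun j => v ∈ anc M (List.finRange d) j := by
    intro j' hj
    simp only [mem_biUnion, mem_filter, mem_univ, true_and] at hj ⊢
    obtain ⟨v, hv, huv⟩ := hj
    exact ⟨v, hv, huv⟩
  refine (card_le_card hsub).trans ?_
  refine (Finset.card_biUnion_le_card_mul _ _ _ fun a _ => desc_card M hM _ a).trans ?_
  have := anc_card M hM (List.finRange d) j
  rw [List.length_finRange] at *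
  calc _ ≤ 2 ^ d * 2 ^ d := Nat.mul_le_mul_right _ this
    _ = 4 ^ d := by rw [← mul_pow]; norm_num

open Classical in
/-- Independence of functions of disjoint sets of coins. -/
lemma indep_sum {n d : ℕ} (S : Set (Fin d × (Fin n × Fin n)))
    (f g : (Fin d → Fin n × Fin n → Bool) → ℝ)
    (hf : ∀ b b', (∀ c ∈ S, b c.1 c.2 = b' c.1 c.2) → f b = f b')
    (hg : ∀ b b', (∀ c, c ∉ S → b c.1 c.2 = b' c.1 c.2) → g b = g b') :
    (∑ b, f b) * (∑ b, g b) =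
      ((Finset.univ : Finset (Fin d → Fin n × Fin n → Bool)).card : ℝ) * ∑ b, f b * g b := by
  let mix : (Fin d → Fin n × Fin n → Bool) → (Fin d → Fin n × Fin n → Bool) →
      (Fin d → Fin n × Fin n → Bool) := fun b b' i p => if (i, p) ∈ S then b i p else b' i p
  let e : ((Fin d → Fin n × Fin n → Bool) × (Fin d → Fin n × Fin n → Bool)) ≃
      ((Fin d → Fin n × Fin n → Bool) × (Fin d → Fin n × Fin n → Bool)) :=
    { toFun := fun z => (mix z.1 z.2, mix z.2 z.1)
      invFun := fun z => (mix z.1 z.2, mix z.2 z.1)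
      left_inv := by
        rintro ⟨z, w⟩
        simp only [mix, Prod.mk.injEq]
        constructor <;> (funext i p; by_cases h : (i, p) ∈ S <;> simp [h])
      right_inv := by
        rintro ⟨z, w⟩
        simp only [mix, Prod.mk.injEq]
        constructor <;> (funext i p; by_cases h : (i, p) ∈ S <;> simp [h]) }
  have h1 : (∑ b, f b) * (∑ b, g b) =
      ∑ z : ((Fin d → Fin n × Fin n → Bool) × (Fin d → Fin n × Fin n → Bool)),
        f z.1 * g z.2 := by
    rw [Finset.sum_mul_sum, Fintype.sum_prod_type]
  have h2 : ((Finset.univ : Finset (Fin d → Fin n × Fin n → Bool)).card : ℝ) *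
      ∑ b, f b * g b =
      ∑ z : ((Fin d → Fin n × Fin n → Bool) × (Fin d → Fin n × Fin n → Bool)),
        f z.1 * g z.1 := by
    rw [Fintype.sum_prod_type]
    simp only [sum_const, nsmul_eq_mul, Finset.mul_sum]
  rw [h1, h2, ← e.sum_comp (fun z => f z.1 * g z.1)]
  refine sum_congr rfl fun z _ => ?_
  have e1 : f (e z).1 = f z.1 := by
    apply hf
    intro c hc
    simp [e, mix, hc]
  have e2 : g (e z).1 = g z.2 := by
    apply hg
    intro c hc
    simp [e, mix, hc]
  rw [e1, e2]

lemma EE_network {n d : ℕ} (M : Fin d → Finset (Fin n × Fin n)) (x₀ : Fin n → Bool)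
    (f : (Fin n → Bool) → ℝ) :
    EE (networkDist M x₀) f = (∑ b, f (networkOutput M b x₀)) /
      ((Finset.univ : Finset (Fin d → Fin n × Fin n → Bool)).card : ℝ) := by
  unfold EE networkDist
  rw [← Finset.sum_fiberwise (s := univ) (g := fun b => networkOutput M b x₀), Finset.sum_div]
  refine sum_congr rfl fun x _ => ?_
  rw [Finset.sum_congr rfl (g := fun _ => f x) (fun b hb => by rw [(mem_filter.mp hb).2])]
  rw [sum_const, nsmul_eq_mul]
  ring

lemma net_indep {n d : ℕ} (M : Fin d → Finset (Fin n × Fin n)) (hM : ∀ i, IsMatching (M i))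
    (x₀ : Fin n → Bool) (a b c e : Fin n)
    (h1 : ¬ dep M a c) (h2 : ¬ dep M a e) (h3 : ¬ dep M b c) (h4 : ¬ dep M b e) :
    EE (networkDist M x₀) (fun x => chi x a * chi x b * (chi x c * chi x e)) =
    EE (networkDist M x₀) (fun x => chi x a * chi x b) *
    EE (networkDist M x₀) (fun x => chi x c * chi x e) := by
  simp only [EE_network]
  have hpos : ((Finset.univ : Finset (Fin d → Fin n × Fin n → Bool)).card : ℝ) ≠ 0 := by
    simp
  rw [div_mul_div_comm, indep_sum
    (coins M (List.finRange d) a ∪ coins M (List.finRange d) b)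
    (fun y => chi (networkOutput M y x₀) a * chi (networkOutput M y x₀) b)
    (fun y => chi (networkOutput M y x₀) c * chi (networkOutput M y x₀) e)]
  · field_simp
  · intro y y' h
    have e1 : networkOutput M y x₀ a = networkOutput M y' x₀ a :=
      net_local M hM _ _ _ _ _ _ (fun _ _ => rfl) (fun c hc => h c (Or.inl hc))
    have e2 : networkOutput M y x₀ b = networkOutput M y' x₀ b :=
      net_local M hM _ _ _ _ _ _ (fun _ _ => rfl) (fun c hc => h c (Or.inr hc))
    simp [chi, e1, e2]
  · intro y y' h
    have e1 : networkOutput M y x₀ c = networkOutput M y' x₀ c := by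
      refine net_local M hM _ _ _ _ _ _ (fun _ _ => rfl) (fun w hc => h w ?_)
      rintro (h | h)
      · exact h1 (coins_disj M _ (List.nodup_finRange d) _ _ w h hc)
      · exact h3 (coins_disj M _ (List.nodup_finRange d) _ _ w h hc)
    have e2 : networkOutput M y x₀ e = networkOutput M y' x₀ e := by
      refine net_local M hM _ _ _ _ _ _ (fun _ _ => rfl) (fun w hc => h w ?_)
      rintro (h | h)
      · exact h2 (coins_disj M _ (List.nodup_finRange d) _ _ w h hc)
      · exact h4 (coins_disj M _ (List.nodup_finRange d) _ _ w h hc)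
    simp [chi, e1, e2]

lemma EE_sum {Ω ι : Type*} [Fintype Ω] (P : Ω → ℝ) (s : Finset ι) (f : ι → Ω → ℝ) :
    EE P (fun x => ∑ i ∈ s, f i x) = ∑ i ∈ s, EE P (f i) := by
  unfold EE
  simp only [Finset.mul_sum]
  exact Finset.sum_comm

lemma EE_var {Ω : Type*} [Fintype Ω] (P : Ω → ℝ) (hP1 : ∑ x, P x = 1) (T : Ω → ℝ) :
    EE P (fun x => (T x - EE P T) ^ 2) = EE P (fun x => T x * T x) - EE P T * EE P T := by
  generalize hm : EE P T = m
  unfold EE at *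
  have : ∀ x, P x * (T x - m) ^ 2 = P x * (T x * T x) - 2 * m * (P x * T x) + m ^ 2 * P x := by
    intro x; ring
  simp only [this, sum_add_distrib, sum_sub_distrib, ← Finset.mul_sum, hm, hP1]
  ring

lemma cheb {Ω : Type*} [Fintype Ω] (P : Ω → ℝ) (hP0 : ∀ x, 0 ≤ P x)
    (T : Ω → ℝ) (m t V : ℝ) (ht : 0 < t) (hV : EE P (fun x => (T x - m) ^ 2) ≤ V)
    (A : Finset Ω) (hA : ∀ x ∈ A, t ≤ |T x - m|) : ∑ x ∈ A, P x ≤ V / t ^ 2 := by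
  rw [le_div_iff₀ (by positivity), Finset.sum_mul]
  refine le_trans ?_ hV
  unfold EE
  calc ∑ x ∈ A, P x * t ^ 2 ≤ ∑ x ∈ A, P x * (T x - m) ^ 2 := by
        apply sum_le_sum
        intro x hx
        apply mul_le_mul_of_nonneg_left _ (hP0 x)
        rw [← sq_abs (T x - m)]
        exact pow_le_pow_left₀ ht.le (hA x hx) 2
    _ ≤ _ := by
        apply sum_le_sum_of_subset_of_nonneg (subset_univ _)
        intro x _ _
        have := hP0 x
        positivity

lemma SD_bound {Ω : Type*} [Fintype Ω] (P Q : Ω → ℝ)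
    (hP0 : ∀ x, 0 ≤ P x) (hP1 : ∑ x, P x = 1) (hQ0 : ∀ x, 0 ≤ Q x)
    (T : Ω → ℝ) (t V : ℝ) (ht : 0 < t)
    (hVP : EE P (fun x => (T x - EE P T) ^ 2) ≤ V)
    (hVQ : EE Q (fun x => (T x - EE Q T) ^ 2) ≤ V)
    (hd : 2 * t ≤ |EE P T - EE Q T|) : 1 - 2 * V / t ^ 2 ≤ SD P Q := by
  classical
  let A : Finset Ω := univ.filter fun x => |T x - EE P T| < t
  have h1 : ∑ x ∈ Aᶜ, P x ≤ V / t ^ 2 := by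
    apply cheb P hP0 T _ t V ht hVP
    intro x hx
    simpa [A] using hx
  have h2 : ∑ x ∈ A, Q x ≤ V / t ^ 2 := by
    apply cheb Q hQ0 T _ t V ht hVQ
    intro x hx
    have hx' : |T x - EE P T| < t := by simpa [A] using hx
    have := abs_sub_le (EE P T) (T x) (EE Q T)
    rw [abs_sub_comm (EE P T) (T x)] at this
    linarith
  have h3 := Finset.sum_add_sum_compl A P
  have h4 : |∑ x ∈ A, P x - ∑ x ∈ A, Q x| ≤ SD P Q := by
    unfold SD
    exact le_ciSup (f := fun A : Finset Ω => |∑ x ∈ A, P x - ∑ x ∈ A, Q x|)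
      (Set.finite_range _).bddAbove A
  have h5 := le_abs_self (∑ x ∈ A, P x - ∑ x ∈ A, Q x)
  have h6 : 2 * V / t ^ 2 = V / t ^ 2 + V / t ^ 2 := by ring
  rw [h6]
  linarith

/-- The test statistic attached to a family of pairs. -/
noncomputable def TT {n : ℕ} (F : Finset (Fin n × Fin n)) (x : Fin n → Bool) : ℝ :=
  ∑ e ∈ F, chi x e.1 * chi x e.2

lemma chi_nonneg {n : ℕ} (x : Fin n → Bool) (a : Fin n) : 0 ≤ chi x a := by
  unfold chi; split <;> norm_num

lemma chi_le_one {n : ℕ} (x : Fin n → Bool) (a : Fin n) : chi x a ≤ 1 := by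
  unfold chi; split <;> norm_num

lemma chi_mul_self {n : ℕ} (x : Fin n → Bool) (a : Fin n) : chi x a * chi x a = chi x a := by
  unfold chi; split <;> norm_num

lemma EE_nonneg {Ω : Type*} [Fintype Ω] (P : Ω → ℝ) (hP0 : ∀ x, 0 ≤ P x) (f : Ω → ℝ)
    (hf : ∀ x, 0 ≤ f x) : 0 ≤ EE P f :=
  sum_nonneg fun x _ => mul_nonneg (hP0 x) (hf x)

lemma EE_le_one {Ω : Type*} [Fintype Ω] (P : Ω → ℝ) (hP0 : ∀ x, 0 ≤ P x)
    (hP1 : ∑ x, P x = 1) (f : Ω → ℝ) (hf : ∀ x, f x ≤ 1) : EE P f ≤ 1 := by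
  rw [← hP1]
  exact sum_le_sum fun x _ => mul_le_of_le_one_right (hP0 x) (hf x)

open Classical in
lemma pair_count {n : ℕ} (R : Fin n → Fin n → Prop) (D : ℕ)
    (hD : ∀ j, (univ.filter fun j' => R j j').card ≤ D) (F : Finset (Fin n × Fin n))
    (hF : ∀ e ∈ F, R e.1 e.2) : F.card ≤ n * D := by
  have hsub : F ⊆ univ.biUnion fun a => (univ.filter fun j' => R a j').image fun c => (a, c) := by
    rintro ⟨a, c⟩ h
    have := hF _ h
    simpa using this
  refine (card_le_card hsub).trans ?_
  refine (Finset.card_biUnion_le_card_mul _ _ D fun a _ => card_image_le.trans (hD a)).trans ?_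
  simp

open Classical in
lemma link_count {n : ℕ} (R : Fin n → Fin n → Prop) (hs : ∀ a b, R a b → R b a) (D : ℕ)
    (hD : ∀ j, (univ.filter fun j' => R j j').card ≤ D) (F : Finset (Fin n × Fin n))
    (hF : ∀ e ∈ F, R e.1 e.2) (e : Fin n × Fin n) :
    (F.filter fun f => R e.1 f.1 ∨ R e.1 f.2 ∨ R e.2 f.1 ∨ R e.2 f.2).card ≤ 4 * D ^ 2 := by
  let G1 : Fin n → Finset (Fin n × Fin n) := fun a => (univ.filter fun j' => R a j').biUnion
    fun c => (univ.filter fun j' => R c j').image fun f => (c, f)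
  let G2 : Fin n → Finset (Fin n × Fin n) := fun a => (univ.filter fun j' => R a j').biUnion
    fun c => (univ.filter fun j' => R c j').image fun f => (f, c)
  have hG1 : ∀ a, (G1 a).card ≤ D ^ 2 := by
    intro a
    refine (Finset.card_biUnion_le_card_mul _ _ D fun a _ => card_image_le.trans (hD a)).trans ?_
    rw [sq]; exact Nat.mul_le_mul_right _ (hD a)
  have hG2 : ∀ a, (G2 a).card ≤ D ^ 2 := by
    intro a
    refine (Finset.card_biUnion_le_card_mul _ _ D fun a _ => card_image_le.trans (hD a)).trans ?_
    rw [sq]; exact Nat.mul_le_mul_right _ (hD a)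
  have hsub : (F.filter fun f => R e.1 f.1 ∨ R e.1 f.2 ∨ R e.2 f.1 ∨ R e.2 f.2) ⊆
      (G1 e.1 ∪ G2 e.1) ∪ (G1 e.2 ∪ G2 e.2) := by
    rintro ⟨c, f⟩ h
    rw [mem_filter] at h
    have h1 := hF _ h.1
    have h2 := hs _ _ h1
    have h3 := h.2
    simp only [mem_union, G1, G2, mem_biUnion, mem_filter, mem_univ, true_and, mem_image,
      Prod.mk.injEq]
    rcases h3 with h3 | h3 | h3 | h3
    · exact Or.inl (Or.inl ⟨c, h3, f, h1, rfl, rfl⟩)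
    · exact Or.inl (Or.inr ⟨f, h3, c, h2, rfl, rfl⟩)
    · exact Or.inr (Or.inl ⟨c, h3, f, h1, rfl, rfl⟩)
    · exact Or.inr (Or.inr ⟨f, h3, c, h2, rfl, rfl⟩)
  have := card_le_card hsub
  have h1 := card_union_le (G1 e.1 ∪ G2 e.1) (G1 e.2 ∪ G2 e.2)
  have h2 := card_union_le (G1 e.1) (G2 e.1)
  have h3 := card_union_le (G1 e.2) (G2 e.2)
  have := hG1 e.1
  have := hG1 e.2
  have := hG2 e.1
  have := hG2 e.2
  omega

open Classical in
lemma var_bound {n : ℕ} (P : (Fin n → Bool) → ℝ) (hP0 : ∀ x, 0 ≤ P x) (hP1 : ∑ x, P x = 1)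
    (R : Fin n → Fin n → Prop) (hs : ∀ a b, R a b → R b a) (D : ℕ)
    (hD : ∀ j, (univ.filter fun j' => R j j').card ≤ D)
    (hneg : ∀ a b c e, ¬ R a c → ¬ R a e → ¬ R b c → ¬ R b e →
      EE P (fun x => chi x a * chi x b * (chi x c * chi x e)) ≤
      EE P (fun x => chi x a * chi x b) * EE P (fun x => chi x c * chi x e))
    (F : Finset (Fin n × Fin n)) (hF : ∀ e ∈ F, R e.1 e.2) :
    EE P (fun x => (TT F x - EE P (TT F)) ^ 2) ≤ 4 * n * (D : ℝ) ^ 3 := by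
  rw [EE_var P hP1]
  have h1 : EE P (TT F) = ∑ e ∈ F, EE P (fun x => chi x e.1 * chi x e.2) := by
    unfold TT; exact EE_sum P F _
  have h2 : EE P (fun x => TT F x * TT F x) = ∑ e ∈ F, ∑ f ∈ F,
      EE P (fun x => chi x e.1 * chi x e.2 * (chi x f.1 * chi x f.2)) := by
    unfold TT
    simp only [Finset.sum_mul_sum]
    rw [EE_sum]
    exact sum_congr rfl fun e _ => EE_sum _ _ _
  rw [h1, h2, Finset.sum_mul_sum, ← Finset.sum_sub_distrib]
  have h3 : ∀ e ∈ F, (∑ f ∈ F, EE P (fun x => chi x e.1 * chi x e.2 * (chi x f.1 * chi x f.2)) -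
      ∑ f ∈ F, EE P (fun x => chi x e.1 * chi x e.2) * EE P (fun x => chi x f.1 * chi x f.2))
      ≤ 4 * (D : ℝ) ^ 2 := by
    intro e _
    rw [← Finset.sum_sub_distrib]
    have h4 := link_count R hs D hD F hF e
    have h5 : ((F.filter fun f => R e.1 f.1 ∨ R e.1 f.2 ∨ R e.2 f.1 ∨ R e.2 f.2).card : ℝ)
        ≤ 4 * (D : ℝ) ^ 2 := by exact_mod_cast h4
    refine le_trans ?_ h5
    rw [Finset.card_filter]
    push_cast
    apply sum_le_sum
    intro f _
    split_ifs with h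
    · have a1 : EE P (fun x => chi x e.1 * chi x e.2 * (chi x f.1 * chi x f.2)) ≤ 1 := by
        apply EE_le_one P hP0 hP1
        intro x
        have := chi_nonneg x e.1
        have := chi_nonneg x e.2
        have := chi_nonneg x f.1
        have := chi_nonneg x f.2
        exact mul_le_one₀ (mul_le_one₀ (chi_le_one _ _) (by assumption) (chi_le_one _ _))
          (by positivity) (mul_le_one₀ (chi_le_one _ _) (by assumption) (chi_le_one _ _))
      have a2 : 0 ≤ EE P (fun x => chi x e.1 * chi x e.2) :=
        EE_nonneg P hP0 _ fun x => mul_nonneg (chi_nonneg _ _) (chi_nonneg _ _)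
      have a3 : 0 ≤ EE P (fun x => chi x f.1 * chi x f.2) :=
        EE_nonneg P hP0 _ fun x => mul_nonneg (chi_nonneg _ _) (chi_nonneg _ _)
      have := mul_nonneg a2 a3
      linarith
    · push Not at h
      have := hneg e.1 e.2 f.1 f.2 h.1 h.2.1 h.2.2.1 h.2.2.2
      linarith
  refine (sum_le_sum h3).trans ?_
  rw [sum_const, nsmul_eq_mul]
  have h6 : (F.card : ℝ) ≤ n * D := by exact_mod_cast pair_count R D hD F hF
  calc (F.card : ℝ) * (4 * (D : ℝ) ^ 2) ≤ (n * D) * (4 * (D : ℝ) ^ 2) :=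
        mul_le_mul_of_nonneg_right h6 (by positivity)
    _ = _ := by ring

/-- Probability that `r` given coordinates are all one in the slice. -/
noncomputable def pr (n k r : ℕ) : ℝ := ((n - r).choose (k - r) : ℝ) / (n.choose k : ℝ)

lemma slice_count {n : ℕ} (k : ℕ) (A : Finset (Fin n)) (hA : A.card ≤ k) :
    (univ.filter fun x : Fin n → Bool => wt x = k ∧ ∀ i ∈ A, x i = true).card =
      (n - A.card).choose (k - A.card) := by
  have hc : (n - A.card).choose (k - A.card) = (powersetCard (k - A.card) (univ \ A)).card := by
    rw [card_powersetCard, card_sdiff_of_subset (subset_univ _), card_univ, Fintype.card_fin]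
  rw [hc]
  apply Finset.card_bij' (fun x _ => (univ.filter fun i => x i = true) \ A)
    (fun s _ => fun i => decide (i ∈ s ∪ A))
  · intro x hx
    simp only [mem_filter, mem_univ, true_and] at hx
    rw [mem_powersetCard]
    refine ⟨sdiff_subset_sdiff (subset_univ _) le_rfl, ?_⟩
    rw [card_sdiff_of_subset (fun i hi => by simpa using hx.2 i hi)]
    rw [← hx.1]; rfl
  · intro s hs
    rw [mem_powersetCard] at hs
    simp only [mem_filter, mem_univ, true_and]
    constructor
    · unfold wt
      simp only [decide_eq_true_eq, Finset.filter_univ_mem]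
      rw [card_union_of_disjoint, hs.2]
      · omega
      · rw [Finset.disjoint_left]
        intro i hi
        have := hs.1 hi
        simp only [mem_sdiff] at this
        exact this.2
    · intro i hi; simp [hi]
  · intro x hx
    simp only [mem_filter, mem_univ, true_and] at hx
    funext i
    by_cases hi : i ∈ A
    · simp [hi, hx.2 i hi]
    · simp [hi]
  · intro s hs
    rw [mem_powersetCard] at hs
    ext i
    by_cases hi : i ∈ s
    · have := hs.1 hi
      simp only [mem_sdiff] at this
      simp [hi, this.2]
    · simp [hi]

lemma EE_slice {n : ℕ} (k : ℕ) (A : Finset (Fin n)) (hA : A.card ≤ k)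
    (f : (Fin n → Bool) → ℝ) (hf : ∀ x, f x = if ∀ i ∈ A, x i = true then 1 else 0) :
    EE (uniformSlice n k) f = pr n k A.card := by
  unfold EE pr uniformSlice
  rw [← slice_count k A hA, Finset.card_filter]
  push_cast
  rw [Finset.sum_div]
  refine sum_congr rfl fun x _ => ?_
  rw [hf]
  by_cases h1 : wt x = k
  · by_cases h2 : ∀ i ∈ A, x i = true
    · rw [if_pos h1, if_pos h2, if_pos ⟨h1, h2⟩]; ring
    · rw [if_neg h2, if_neg (c := _ ∧ _) (fun h => h2 h.2)]; simp
  · rw [if_neg h1, if_neg (c := _ ∧ _) (fun h => h1 h.1)]; simp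

lemma pr_zero {n k : ℕ} (hk : k ≤ n) : pr n k 0 = 1 := by
  unfold pr
  have : (n.choose k : ℝ) ≠ 0 := by exact_mod_cast (Nat.choose_pos hk).ne'
  simp [this]

lemma pr_succ {n k r : ℕ} (hk : k ≤ n) (hr : r < k) :
    pr n k (r + 1) = pr n k r * (((k : ℝ) - r) / ((n : ℝ) - r)) := by
  unfold pr
  have h1 : (n.choose k : ℝ) ≠ 0 := by exact_mod_cast (Nat.choose_pos hk).ne'
  have h2 : (n : ℝ) - r ≠ 0 := by
    have : (r : ℝ) < n := by exact_mod_cast lt_of_lt_of_le hr hk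
    linarith
  obtain ⟨a, rfl⟩ : ∃ a, k = r + 1 + a := ⟨k - (r + 1), by omega⟩
  obtain ⟨b, rfl⟩ : ∃ b, n = r + 1 + b := ⟨n - (r + 1), by omega⟩
  have e1 : r + 1 + b - (r + 1) = b := by omega
  have e2 : r + 1 + a - (r + 1) = a := by omega
  have e3 : r + 1 + b - r = b + 1 := by omega
  have e4 : r + 1 + a - r = a + 1 := by omega
  rw [e1, e2, e3, e4]
  have h3 := Nat.add_one_mul_choose_eq b a
  have h4 : ((b : ℝ) + 1) * (b.choose a) = ((b + 1).choose (a + 1)) * ((a : ℝ) + 1) := by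
    exact_mod_cast h3
  push_cast at h2 ⊢
  have e5 : (r : ℝ) + 1 + b - r = b + 1 := by ring
  have e6 : (r : ℝ) + 1 + a - r = a + 1 := by ring
  rw [e5] at h2 ⊢
  rw [e6]
  field_simp
  linarith

lemma slice_mass {n k : ℕ} (hk : k ≤ n) : ∑ x, uniformSlice n k x = 1 := by
  have := EE_slice (n := n) k ∅ (by simp) (fun _ => 1) (by simp)
  rw [card_empty, pr_zero hk] at this
  simpa [EE] using this

lemma slice_nonneg {n k : ℕ} (x) : 0 ≤ uniformSlice n k x := by
  unfold uniformSlice; split <;> positivity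

lemma slice_two {n k : ℕ} (hk : 4 ≤ k) (a b : Fin n) :
    EE (uniformSlice n k) (fun x => chi x a * chi x b) = pr n k ({a, b} : Finset (Fin n)).card := by
  apply EE_slice
  · exact card_le_two.trans (by omega)
  · intro x
    simp only [chi, mem_insert, mem_singleton, forall_eq_or_imp, forall_eq]
    by_cases h1 : x a = true <;> by_cases h2 : x b = true <;> simp [h1, h2]

lemma slice_four {n k : ℕ} (hk : 4 ≤ k) (a b c e : Fin n) :
    EE (uniformSlice n k) (fun x => chi x a * chi x b * (chi x c * chi x e)) =
      pr n k ({a, b, c, e} : Finset (Fin n)).card := by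
  apply EE_slice
  · exact card_le_four.trans hk
  · intro x
    simp only [chi, mem_insert, mem_singleton, forall_eq_or_imp, forall_eq]
    by_cases h1 : x a = true <;> by_cases h2 : x b = true <;> by_cases h3 : x c = true <;>
      by_cases h4 : x e = true <;> simp [h1, h2, h3, h4]

lemma pr_one {n k : ℕ} (hk : k ≤ n) (h4 : 4 ≤ k) : pr n k 1 = (k : ℝ) / n := by
  rw [show (1 : ℕ) = 0 + 1 from rfl, pr_succ hk (by omega), pr_zero hk]; simp

lemma pr_two {n k : ℕ} (hk : k ≤ n) (h4 : 4 ≤ k) :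
    pr n k 2 = (k : ℝ) / n * (((k : ℝ) - 1) / ((n : ℝ) - 1)) := by
  rw [show (2 : ℕ) = 1 + 1 from rfl, pr_succ hk (by omega), pr_one hk h4]; simp

lemma slice_neg {n k : ℕ} (hk : k ≤ n) (h4 : 4 ≤ k) (a b c e : Fin n)
    (h1 : a ≠ c) (h2 : a ≠ e) (h3 : b ≠ c) (h5 : b ≠ e) :
    EE (uniformSlice n k) (fun x => chi x a * chi x b * (chi x c * chi x e)) ≤
    EE (uniformSlice n k) (fun x => chi x a * chi x b) *
    EE (uniformSlice n k) (fun x => chi x c * chi x e) := by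
  rw [slice_two h4, slice_two h4, slice_four h4]
  have p1 := pr_one hk h4
  have p2 := pr_two hk h4
  have p3 : pr n k 3 = pr n k 2 * (((k : ℝ) - 2) / ((n : ℝ) - 2)) := by
    rw [show (3 : ℕ) = 2 + 1 from rfl, pr_succ hk (by omega)]; simp
  have p4 : pr n k 4 = pr n k 3 * (((k : ℝ) - 3) / ((n : ℝ) - 3)) := by
    rw [show (4 : ℕ) = 3 + 1 from rfl, pr_succ hk (by omega)]; simp
  have hkr : (4 : ℝ) ≤ k := by exact_mod_cast h4
  have hnr : (k : ℝ) ≤ n := by exact_mod_cast hk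
  have q0 : 0 ≤ (k : ℝ) / n := by positivity
  have q1 : 0 ≤ ((k : ℝ) - 1) / ((n : ℝ) - 1) := div_nonneg (by linarith) (by linarith)
  have q2 : 0 ≤ ((k : ℝ) - 2) / ((n : ℝ) - 2) := div_nonneg (by linarith) (by linarith)
  have q3 : 0 ≤ ((k : ℝ) - 3) / ((n : ℝ) - 3) := div_nonneg (by linarith) (by linarith)
  have r1 : ((k : ℝ) - 1) / ((n : ℝ) - 1) ≤ (k : ℝ) / n := by
    rw [div_le_div_iff₀ (by linarith) (by linarith)]; nlinarith
  have r2 : ((k : ℝ) - 2) / ((n : ℝ) - 2) ≤ (k : ℝ) / n := by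
    rw [div_le_div_iff₀ (by linarith) (by linarith)]; nlinarith
  have r3 : ((k : ℝ) - 3) / ((n : ℝ) - 3) ≤ ((k : ℝ) - 1) / ((n : ℝ) - 1) := by
    rw [div_le_div_iff₀ (by linarith) (by linarith)]; nlinarith
  rw [p2] at p3
  rw [p3] at p4
  have s2 : pr n k 2 ≤ pr n k 1 * pr n k 1 := by
    rw [p2, p1]; exact mul_le_mul_of_nonneg_left r1 q0
  have s3 : pr n k 3 ≤ pr n k 2 * pr n k 1 := by
    rw [p3, p2, p1]; exact mul_le_mul_of_nonneg_left r2 (mul_nonneg q0 q1)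
  have s4 : pr n k 4 ≤ pr n k 2 * pr n k 2 := by
    rw [p4, p2, mul_assoc]
    exact mul_le_mul_of_nonneg_left (mul_le_mul r2 r3 q3 q0) (mul_nonneg q0 q1)
  by_cases hab : a = b <;> by_cases hce : c = e
  · subst hab hce
    have : ({a, a, c, c} : Finset (Fin n)).card = 2 := by simp [h1]
    rw [this]; simpa using s2
  · subst hab
    have : ({a, a, c, e} : Finset (Fin n)).card = 3 := by
      rw [insert_eq_of_mem (by simp)]; exact card_eq_three.mpr ⟨a, c, e, h1, h2, hce, rfl⟩
    rw [this, card_pair hce]; simpa [mul_comm] using s3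
  · subst hce
    have : ({a, b, c, c} : Finset (Fin n)).card = 3 := by
      rw [pair_eq_singleton]; exact card_eq_three.mpr ⟨a, b, c, hab, h1, h3, rfl⟩
    rw [this, card_pair hab]; simpa using s3
  · have : ({a, b, c, e} : Finset (Fin n)).card = 4 := by
      rw [card_insert_of_notMem, card_eq_three.mpr ⟨b, c, e, h3, h5, hce, rfl⟩]
      simp [hab, h1, h2]
    rw [this, card_pair hab, card_pair hce]; exact s4

lemma sum_chi {n : ℕ} (x : Fin n → Bool) : ∑ a, chi x a = (wt x : ℝ) := by
  unfold chi wt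
  rw [Finset.card_filter]; push_cast; rfl

lemma wt_init {n k : ℕ} (hk : k ≤ n) : wt (initString n k) = k := by
  unfold wt initString
  simp only [decide_eq_true_eq]
  rw [Fin.card_filter_val_lt]
  omega

lemma net_nonneg {n d : ℕ} (M : Fin d → Finset (Fin n × Fin n)) (x₀ x : Fin n → Bool) :
    0 ≤ networkDist M x₀ x := by
  unfold networkDist; positivity

lemma net_mass {n d : ℕ} (M : Fin d → Finset (Fin n × Fin n)) (x₀ : Fin n → Bool) :
    ∑ x, networkDist M x₀ x = 1 := by
  have := EE_network M x₀ (fun _ => 1)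
  simpa [EE] using this

/-- The network distribution lives on one slice. -/
lemma EE_net_wt {n d : ℕ} (M : Fin d → Finset (Fin n × Fin n)) (x₀ : Fin n → Bool)
    (g : ℝ → ℝ) :
    EE (networkDist M x₀) (fun x => g (∑ a, chi x a)) = g (wt x₀) := by
  rw [EE_network]
  simp only [sum_chi, wt_net]
  rw [sum_const, nsmul_eq_mul]
  have hpos : ((Finset.univ : Finset (Fin d → Fin n × Fin n → Bool)).card : ℝ) ≠ 0 := by
    simp
  field_simp

open Classical in
/-- Pairs of dependent positions. -/
noncomputable def depPairs {n d : ℕ} (M : Fin d → Finset (Fin n × Fin n)) :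
    Finset (Fin n × Fin n) := univ.filter fun e => dep M e.1 e.2

lemma EE_TT {n : ℕ} (P : (Fin n → Bool) → ℝ) (F : Finset (Fin n × Fin n)) :
    EE P (TT F) = ∑ e ∈ F, EE P (fun x => chi x e.1 * chi x e.2) := by
  unfold TT; exact EE_sum P F _

lemma net_quad {n d : ℕ} (M : Fin d → Finset (Fin n × Fin n)) (hM : ∀ i, IsMatching (M i))
    (x₀ : Fin n → Bool) :
    EE (networkDist M x₀) (TT (depPairs M)) = ∑ e ∈ depPairs M,
      EE (networkDist M x₀) (fun x => chi x e.1) * EE (networkDist M x₀) (fun x => chi x e.2) := by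
  rw [EE_TT, ← sub_eq_zero, ← Finset.sum_sub_distrib]
  have h1 : ∑ e ∈ depPairs M, (EE (networkDist M x₀) (fun x => chi x e.1 * chi x e.2) -
      EE (networkDist M x₀) (fun x => chi x e.1) * EE (networkDist M x₀) (fun x => chi x e.2)) =
      ∑ e : Fin n × Fin n, (EE (networkDist M x₀) (fun x => chi x e.1 * chi x e.2) -
      EE (networkDist M x₀) (fun x => chi x e.1) *
        EE (networkDist M x₀) (fun x => chi x e.2)) := by
    apply sum_subset (subset_univ _)
    intro e _ he
    have he' : ¬ dep M e.1 e.2 := by simpa [depPairs] using he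
    have := net_indep M hM x₀ e.1 e.1 e.2 e.2 he' he' he' he'
    simp only [chi_mul_self] at this
    rw [this, sub_self]
  rw [h1, Fintype.sum_prod_type]
  simp only [Finset.sum_sub_distrib]
  rw [← Finset.sum_mul_sum]
  have h2 : ∑ a, EE (networkDist M x₀) (fun x => chi x a) = wt x₀ := by
    rw [← EE_sum]; exact EE_net_wt M x₀ (fun t => t)
  have h3 : ∑ a, ∑ b, EE (networkDist M x₀) (fun x => chi x a * chi x b) =
      (wt x₀ : ℝ) * wt x₀ := by
    have := EE_net_wt M x₀ (fun t => t * t)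
    rw [← this]
    simp only [Finset.sum_mul_sum]
    rw [EE_sum]
    exact sum_congr rfl fun a _ => (EE_sum _ _ _).symm
  rw [h2, h3, sub_self]

lemma slice_quad {n k d : ℕ} (M : Fin d → Finset (Fin n × Fin n)) (hM : ∀ i, IsMatching (M i))
    (α : ℝ) (hα : 0 < α) (hα1 : α < 1) (hk4 : 4 ≤ k) (hk : (k : ℝ) = α * n) (hkn : k ≤ n)
    (hn : 4 * (4 : ℝ) ^ d ≤ n) :
    ((depPairs M).card : ℝ) * α ^ 2 + n * (α * (1 - α)) / 2 ≤
      EE (uniformSlice n k) (TT (depPairs M)) := by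
  classical
  have hn4 : (4 : ℝ) ≤ n := by
    have : (4 : ℝ) ≤ k := by exact_mod_cast hk4
    have : (k : ℝ) ≤ n := by exact_mod_cast hkn
    linarith
  have hβ : 0 < α * (1 - α) := mul_pos hα (by linarith)
  have q1 : (k : ℝ) / n = α := by rw [hk]; field_simp
  have q2 : pr n k 2 = α ^ 2 - α * (1 - α) / (n - 1) := by
    rw [pr_two hkn hk4, q1, hk]
    have : (n : ℝ) - 1 ≠ 0 := by linarith
    field_simp
    ring
  have hterm : ∀ e ∈ depPairs M, α ^ 2 - α * (1 - α) / (n - 1) +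
      (if e.1 = e.2 then α * (1 - α) else 0) ≤
      EE (uniformSlice n k) (fun x => chi x e.1 * chi x e.2) := by
    intro e _
    rw [slice_two hk4]
    split_ifs with h
    · rw [h, pair_eq_singleton, card_singleton, pr_one hkn hk4, q1]
      have : 0 ≤ α * (1 - α) / (n - 1) := div_nonneg hβ.le (by linarith)
      nlinarith
    · rw [card_pair h, q2]; simp
  rw [EE_TT]
  refine le_trans ?_ (sum_le_sum hterm)
  rw [sum_add_distrib, sum_const, nsmul_eq_mul]
  have hdiag : ∑ e ∈ depPairs M, (if e.1 = e.2 then α * (1 - α) else 0) = n * (α * (1 - α)) := by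
    unfold depPairs
    rw [sum_filter, Fintype.sum_prod_type]
    have : ∀ a b : Fin n, (if dep M a b then (if a = b then α * (1 - α) else 0) else 0) =
        if a = b then α * (1 - α) else 0 := by
      intro a b
      by_cases h : a = b
      · subst h; simp [dep_refl]
      · simp [h]
    simp [this]
  rw [hdiag]
  have hcard : ((depPairs M).card : ℝ) ≤ n * 4 ^ d := by
    exact_mod_cast pair_count (dep M) (4 ^ d) (fun j => by convert dep_card M hM j) (depPairs M)
      (fun e he => by simpa [depPairs] using he)
  have h5 : ((depPairs M).card : ℝ) * (α * (1 - α) / (n - 1)) ≤ n * (α * (1 - α)) / 2 := by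
    rw [mul_div_assoc', div_le_iff₀ (by linarith)]
    have : ((depPairs M).card : ℝ) ≤ n / 2 * (n - 1) := by nlinarith
    nlinarith
  rw [mul_sub (((depPairs M).card : ℝ)) (α ^ 2)]
  linarith

lemma core {n k d : ℕ} (M : Fin d → Finset (Fin n × Fin n)) (hM : ∀ i, IsMatching (M i))
    (α : ℝ) (hα : 0 < α) (hα1 : α < 1) (hk4 : 4 ≤ k) (hk : (k : ℝ) = α * n)
    (hn : 4 * (4 : ℝ) ^ d ≤ n) :
    1 - 8192 * ((4 : ℝ) ^ d) ^ 5 / (n * (α * (1 - α)) ^ 2) ≤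
      SD (networkDist M (initString n k)) (uniformSlice n k) := by
  classical
  have hkn : k ≤ n := by
    have h0 : (0 : ℝ) ≤ n := by positivity
    have : (k : ℝ) ≤ n := by rw [hk]; nlinarith
    exact_mod_cast this
  have hn4 : (4 : ℝ) ≤ n := by exact_mod_cast hk4.trans hkn
  have hβ : 0 < α * (1 - α) := mul_pos hα (by linarith)
  have q1 : (k : ℝ) / n = α := by rw [hk]; field_simp
  have hDpos : (0 : ℝ) < 4 ^ d := by positivity
  have hD : ∀ j, (univ.filter fun j' => dep M j j').card ≤ 4 ^ d :=
    fun j => by convert dep_card M hM j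
  have hF : ∀ e ∈ depPairs M, dep M e.1 e.2 := fun e he => by simpa [depPairs] using he
  set P := networkDist M (initString n k) with hP
  set Q := uniformSlice n k with hQ
  set β := α * (1 - α) with hβdef
  set D : ℝ := (4 : ℝ) ^ d with hDdef
  have hcast : ((4 ^ d : ℕ) : ℝ) = D := by push_cast; rfl
  have main : ∀ F : Finset (Fin n × Fin n), (∀ e ∈ F, dep M e.1 e.2) →
      2 * (n * β / (32 * D)) ≤ |EE P (TT F) - EE Q (TT F)| →
      1 - 8192 * D ^ 5 / (n * β ^ 2) ≤ SD P Q := by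
    intro F hF hd
    have h1 := var_bound P (net_nonneg M _) (net_mass M _) (dep M) (dep_symm M) (4 ^ d) hD
      (fun a b c e h1 h2 h3 h4 => (net_indep M hM _ a b c e h1 h2 h3 h4).le) F hF
    have h2 := var_bound Q slice_nonneg (slice_mass hkn) (dep M) (dep_symm M) (4 ^ d) hD
      (fun a b c e h1 h2 h3 h4 => slice_neg hkn hk4 a b c e
        (fun h => h1 (h ▸ dep_refl M a)) (fun h => h2 (h ▸ dep_refl M a))
        (fun h => h3 (h ▸ dep_refl M b)) (fun h => h4 (h ▸ dep_refl M b))) F hF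
    rw [hcast] at h1 h2
    have h3 := SD_bound P Q (net_nonneg M _) (net_mass M _) slice_nonneg (TT F)
      (n * β / (32 * D)) _ (by positivity) h1 h2 hd
    refine le_trans (le_of_eq ?_) h3
    have : (n : ℝ) ≠ 0 := by linarith
    field_simp
    ring
  let μ : Fin n → ℝ := fun a => EE P (fun x => chi x a)
  have hμ0 : ∀ a, 0 ≤ μ a := fun a => EE_nonneg P (net_nonneg M _) _ fun x => chi_nonneg x a
  have hμ1 : ∀ a, μ a ≤ 1 :=
    fun a => EE_le_one P (net_nonneg M _) (net_mass M _) _ fun x => chi_le_one x a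
  have hμs : ∑ a, μ a = k := by
    have := EE_net_wt M (initString n k) (fun t => t)
    rw [EE_sum, wt_init hkn] at this
    exact this
  have hνs : ∑ a, (μ a - α) = 0 := by
    rw [sum_sub_distrib, hμs, hk]; simp [mul_comm]
  by_cases hcase : ∑ a, |μ a - α| ≤ n * β / (8 * D)
  · apply main (depPairs M) hF
    have h1 := slice_quad M hM α hα hα1 hk4 hk hkn hn
    have h2 := net_quad M hM (initString n k)
    have h3 : EE P (TT (depPairs M)) - ((depPairs M).card : ℝ) * α ^ 2 ≤ n * β / 4 := by
      rw [h2, ← nsmul_eq_mul, ← sum_const, ← sum_sub_distrib]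
      have hb : ∀ e ∈ depPairs M, μ e.1 * μ e.2 - α ^ 2 ≤ |μ e.1 - α| + |μ e.2 - α| := by
        intro e _
        have a1 : (μ e.1 - α) * μ e.2 ≤ |μ e.1 - α| := by
          calc (μ e.1 - α) * μ e.2 ≤ |μ e.1 - α| * μ e.2 :=
                mul_le_mul_of_nonneg_right (le_abs_self _) (hμ0 _)
            _ ≤ _ := mul_le_of_le_one_right (abs_nonneg _) (hμ1 _)
        have a2 : (μ e.2 - α) * α ≤ |μ e.2 - α| := by
          calc (μ e.2 - α) * α ≤ |μ e.2 - α| * α :=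
                mul_le_mul_of_nonneg_right (le_abs_self _) hα.le
            _ ≤ _ := mul_le_of_le_one_right (abs_nonneg _) hα1.le
        nlinarith
      refine (sum_le_sum hb).trans ?_
      rw [sum_add_distrib]
      have hdc : ∀ a, ((univ.filter fun j' => dep M a j').card : ℝ) ≤ D := by
        intro a; rw [← hcast]; exact_mod_cast hD a
      have s1 : ∑ e ∈ depPairs M, |μ e.1 - α| ≤ D * ∑ a, |μ a - α| := by
        unfold depPairs
        rw [sum_filter, Fintype.sum_prod_type, Finset.mul_sum]
        apply sum_le_sum
        intro a _
        simp only
        rw [← sum_filter, sum_const, nsmul_eq_mul]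
        exact mul_le_mul_of_nonneg_right (hdc a) (abs_nonneg _)
      have s2 : ∑ e ∈ depPairs M, |μ e.2 - α| ≤ D * ∑ a, |μ a - α| := by
        unfold depPairs
        rw [sum_filter, Fintype.sum_prod_type_right, Finset.mul_sum]
        apply sum_le_sum
        intro a _
        simp only
        rw [← sum_filter, sum_const, nsmul_eq_mul]
        refine mul_le_mul_of_nonneg_right (le_trans ?_ (hdc a)) (abs_nonneg _)
        apply le_of_eq
        congr 2
        ext j
        simp only [mem_filter, mem_univ, true_and]
        exact ⟨dep_symm M _ _, dep_symm M _ _⟩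
      have s3 : D * ∑ a, |μ a - α| ≤ D * (n * β / (8 * D)) :=
        mul_le_mul_of_nonneg_left hcase hDpos.le
      have s4 : D * (n * β / (8 * D)) = n * β / 8 := by field_simp
      linarith
    have h4 : n * β / 4 ≤ EE Q (TT (depPairs M)) - EE P (TT (depPairs M)) := by linarith
    have h5 : 2 * (n * β / (32 * D)) ≤ n * β / 4 := by
      have hD1 : 1 ≤ D := one_le_pow₀ (by norm_num)
      rw [mul_div_assoc', div_le_div_iff₀ (by positivity) (by norm_num)]
      have : 0 ≤ n * β := by positivity
      nlinarith
    rw [abs_sub_comm]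
    exact h5.trans (h4.trans (le_abs_self _))
  · push Not at hcase
    let S : Finset (Fin n) := univ.filter fun a => 0 ≤ μ a - α
    let F : Finset (Fin n × Fin n) := S.image fun a => (a, a)
    apply main F
    · intro e he
      simp only [F, mem_image] at he
      obtain ⟨a, _, rfl⟩ := he
      exact dep_refl M a
    · have e1 : EE P (TT F) = ∑ a ∈ S, μ a := by
        rw [EE_TT, sum_image (fun a _ b _ h => (Prod.mk.inj h).1)]
        simp only [chi_mul_self]; rfl
      have e2 : EE Q (TT F) = ∑ a ∈ S, α := by
        rw [EE_TT, sum_image (fun a _ b _ h => (Prod.mk.inj h).1)]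
        refine sum_congr rfl fun a _ => ?_
        rw [slice_two hk4, pair_eq_singleton, card_singleton, pr_one hkn hk4, q1]
      rw [e1, e2, ← sum_sub_distrib]
      have e3 : ∑ a, |μ a - α| = 2 * ∑ a ∈ S, (μ a - α) := by
        have : ∀ a, |μ a - α| = 2 * (if 0 ≤ μ a - α then μ a - α else 0) - (μ a - α) := by
          intro a
          split_ifs with h
          · rw [abs_of_nonneg h]; ring
          · rw [abs_of_neg (not_le.mp h)]; ring
        simp only [this]
        rw [sum_sub_distrib, hνs, ← Finset.mul_sum, ← sum_filter, sub_zero]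
      refine le_trans ?_ (le_abs_self _)
      have e4 : n * β / (8 * D) = 4 * (n * β / (32 * D)) := by field_simp; norm_num
      rw [e4] at hcase
      linarith

/-- Let `α, δ ∈ (0,1)` be constants. There are `c > 0` and `N` such that
for all `n ≥ N` with `αn` an integer `k`, every switching network of depth `d` on `[n]`
that (started from `1^{αn} 0^{n-αn}`) generates a distribution within statistical distance
`1 - δ` of `U_{αn}^n` satisfies `d ≥ c log log n`. -/
theorem stmt19 (α δ : ℝ) (hα : 0 < α) (hα1 : α < 1) (hδ : 0 < δ) (hδ1 : δ < 1) :
    ∃ (c : ℝ) (N : ℕ), 0 < c ∧ ∀ n k : ℕ, N ≤ n → (k : ℝ) = α * n →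
      ∀ (d : ℕ) (M : Fin d → Finset (Fin n × Fin n)), (∀ i, IsMatching (M i)) →
        SD (networkDist M (initString n k)) (uniformSlice n k) ≤ 1 - δ →
        c * Real.log (Real.log n) ≤ (d : ℝ) := by
  have hβ : 0 < α * (1 - α) := mul_pos hα (by linarith)
  have hβ1 : α * (1 - α) ≤ 1 := by nlinarith
  set β := α * (1 - α) with hβdef
  let K : ℝ := 8192 / (δ * β ^ 2)
  have hK : 4 ≤ K := by
    have : δ * β ^ 2 ≤ 1 := mul_le_one₀ hδ1.le (by positivity) (pow_le_one₀ hβ.le hβ1)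
    rw [le_div_iff₀ (by positivity)]
    linarith
  refine ⟨1 / 40, ⌈K ^ 2⌉₊ + ⌈4 / α⌉₊, by norm_num, ?_⟩
  intro n k hN hk d M hM hSD
  have hNr : (⌈K ^ 2⌉₊ : ℝ) + ⌈4 / α⌉₊ ≤ n := by exact_mod_cast hN
  have c1 := Nat.le_ceil (K ^ 2)
  have c2 := Nat.le_ceil (4 / α)
  have hKn : K ^ 2 ≤ n := by
    have : (0 : ℝ) ≤ ⌈4 / α⌉₊ := by positivity
    linarith
  have hk4 : 4 ≤ k := by
    have h1 : 4 / α ≤ n := by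
      have : (0 : ℝ) ≤ ⌈K ^ 2⌉₊ := by positivity
      linarith
    rw [div_le_iff₀ hα] at h1
    have : (4 : ℝ) ≤ k := by rw [hk]; linarith
    exact_mod_cast this
  have hn1 : (16 : ℝ) ≤ n := by nlinarith
  have hnK : (n : ℝ) ≤ K * ((4 : ℝ) ^ d) ^ 5 := by
    by_contra hcon
    push Not at hcon
    have hD1 : (1 : ℝ) ≤ 4 ^ d := one_le_pow₀ (by norm_num)
    have hD5 : (4 : ℝ) ^ d ≤ (4 ^ d) ^ 5 := le_self_pow₀ hD1 (by norm_num)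
    have h1 := core M hM α hα hα1 hk4 hk (by nlinarith)
    have h2 : δ ≤ 8192 * ((4 : ℝ) ^ d) ^ 5 / (n * β ^ 2) := by linarith
    rw [le_div_iff₀ (by positivity)] at h2
    have h3 : K * ((4 : ℝ) ^ d) ^ 5 * (δ * β ^ 2) = 8192 * ((4 : ℝ) ^ d) ^ 5 := by
      simp only [K]; field_simp
    have h4 := mul_lt_mul_of_pos_right hcon (show 0 < δ * β ^ 2 by positivity)
    nlinarith
  have hnpos : (0 : ℝ) < n := by linarith
  have hlog : Real.log n ≤ Real.log K + 5 * (d * Real.log 4) := by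
    have := Real.log_le_log hnpos hnK
    rw [Real.log_mul (by positivity) (by positivity), Real.log_pow, Real.log_pow] at this
    push_cast at this
    linarith
  have hlogK : 2 * Real.log K ≤ Real.log n := by
    have := Real.log_le_log (by positivity) hKn
    rw [Real.log_pow] at this
    push_cast at this
    linarith
  have hlog4 : Real.log 4 ≤ 3 := by
    have := Real.log_le_sub_one_of_pos (show (0 : ℝ) < 4 by norm_num)
    linarith
  have hlog0 : 0 ≤ Real.log n := Real.log_nonneg (by linarith)
  have hll : Real.log (Real.log n) ≤ Real.log n := Real.log_le_self hlog0
  have hd : (d : ℝ) * Real.log 4 ≤ d * 3 := mul_le_mul_of_nonneg_left hlog4 (by positivity)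
  linarith
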